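/- arXiv:1112.1338 — 4 statements merged into one kernel-verified Lean document; each statement's English description precedes it below -/
import Mathlib

section
/- Under assumption A3 (arc balance with constant A > 1) and assuming solutions exist from every initial time and initial state, if the continuous-time belief evolution achieves global ε-agreement, then there exist constants a* > 0 and τ0 > 0 such that ∫_t^{t+τ0} W_ij(s) ds ≥ a* for every t ≥ 0 and every persistent arc (j,i) of G^p. -/
open Filter Finset MeasureTheory

/-- `ReachIn R k i j`: `j` can be reached from `i` in exactly `k` steps following relation `R`. -/
def ReachIn {α : Type*} (R : α → α → Prop) : ℕ → α → α → Prop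
  | 0 => fun i j => i = j
  | k + 1 => fun i j => ∃ m, R i m ∧ ReachIn R k m j

/-- Distance from `i` to `j`: length of a shortest directed path. -/
noncomputable def distR {α : Type*} (R : α → α → Prop) (i j : α) : ℕ :=
  sInf {k | ReachIn R k i j}

/-- Diameter: maximum of `distR i j` over pairs with `j` reachable from `i`. -/
noncomputable def diamR {α : Type*} (R : α → α → Prop) : ℕ :=
  sSup {d | ∃ i j, (∃ k, ReachIn R k i j) ∧ d = distR R i j}

/-- Regularity of the weight functions: nonnegative, measurable and locally integrable. -/
def CRegular (n : ℕ) (W : ℝ → Fin n → Fin n → ℝ) : Prop :=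
  (∀ t i j, 0 ≤ W t i j) ∧ (∀ i j, Measurable fun t => W t i j) ∧
    (∀ i j, LocallyIntegrable (fun t => W t i j))

/-- A (Caratheodory) solution of the continuous-time belief evolution with initial time `t0`,
written in integral form. -/
def CSol (n : ℕ) (W : ℝ → Fin n → Fin n → ℝ) (t0 : ℝ) (x : ℝ → Fin n → ℝ) : Prop :=
  (∀ i, ContinuousOn (fun t => x t i) (Set.Ici t0)) ∧
    ∀ i : Fin n, ∀ t : ℝ, t0 ≤ t →
      x t i = x t0 i + ∫ s in t0..t, ∑ j, W s i j * (x s j - x s i)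

/-- Solutions exist from every initial time `t0 ≥ 0` and every initial state. -/
def CSolExists (n : ℕ) (W : ℝ → Fin n → Fin n → ℝ) : Prop :=
  ∀ t0 : ℝ, 0 ≤ t0 → ∀ x0 : Fin n → ℝ, ∃ x : ℝ → Fin n → ℝ,
    CSol n W t0 x ∧ ∀ i, x t0 i = x0 i

/-- Maximum state Ψ(t). -/
noncomputable def cMax (n : ℕ) (x : ℝ → Fin n → ℝ) (t : ℝ) : ℝ := ⨆ i, x t i

/-- Minimum state ψ(t). -/
noncomputable def cMin (n : ℕ) (x : ℝ → Fin n → ℝ) (t : ℝ) : ℝ := ⨅ i, x t i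

/-- Agreement measure H(t) = Ψ(t) − ψ(t). -/
noncomputable def cH (n : ℕ) (x : ℝ → Fin n → ℝ) (t : ℝ) : ℝ := cMax n x t - cMin n x t

/-- `(j,i)` is a persistent arc: `j ≠ i` and `∫_s^∞ W_ij(t) dt = ∞` for every `s ≥ 0`. -/
def CPersistent (n : ℕ) (W : ℝ → Fin n → Fin n → ℝ) (j i : Fin n) : Prop :=
  j ≠ i ∧ ∀ s : ℝ, 0 ≤ s → Tendsto (fun T => ∫ t in s..T, W t i j) atTop atTop

/-- The persistent graph is quasi-strongly connected: it has a center. -/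
def CQSC (n : ℕ) (W : ℝ → Fin n → Fin n → ℝ) : Prop :=
  ∃ c : Fin n, ∀ v : Fin n, ∃ k, ReachIn (CPersistent n W) k c v

/-- A3 (arc balance) with constant `A`. -/
def CArcBalance (n : ℕ) (W : ℝ → Fin n → Fin n → ℝ) (A : ℝ) : Prop :=
  ∀ t : ℝ, 0 ≤ t → ∀ i j k m : Fin n, CPersistent n W j i → CPersistent n W m k →
    A⁻¹ * W t i j ≤ W t k m ∧ W t k m ≤ A * W t i j

/-- Global agreement for the continuous-time evolution. -/
def CAgree (n : ℕ) (W : ℝ → Fin n → Fin n → ℝ) : Prop :=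
  ∀ t0 : ℝ, 0 ≤ t0 → ∀ x : ℝ → Fin n → ℝ, CSol n W t0 x →
    Tendsto (cH n x) atTop (nhds 0)

/-- Global ε-agreement for the continuous-time evolution. -/
def CEpsAgree (n : ℕ) (W : ℝ → Fin n → Fin n → ℝ) : Prop :=
  ∃ ε : ℝ, 0 < ε ∧ ε < 1 ∧ ∃ T0 : ℝ, 0 < T0 ∧
    ∀ t0 : ℝ, 0 ≤ t0 → ∀ x : ℝ → Fin n → ℝ, CSol n W t0 x →
      ∀ t, t0 ≤ t → cH n x (t + T0) ≤ ε * cH n x t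

/-- Condition (b): uniformly positive integrals over windows of length `τ0` for persistent arcs. -/
def CArcCond (n : ℕ) (W : ℝ → Fin n → Fin n → ℝ) : Prop :=
  ∃ a : ℝ, 0 < a ∧ ∃ τ : ℝ, 0 < τ ∧
    ∀ t : ℝ, 0 ≤ t → ∀ j i : Fin n, CPersistent n W j i →
      a ≤ ∫ s in t..(t + τ), W s i j

open scoped Classical in
/-- θ(t): total weight at time `t` over non-persistent ordered pairs of distinct nodes. -/
noncomputable def cTheta (n : ℕ) (W : ℝ → Fin n → Fin n → ℝ) (t : ℝ) : ℝ :=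
  ∑ i : Fin n, ∑ j : Fin n, if j ≠ i ∧ ¬ CPersistent n W j i then W t i j else 0

/-- ξ⁺(t;m) = ∑_{j ≠ m} W_mj(t). -/
def cXi (n : ℕ) (W : ℝ → Fin n → Fin n → ℝ) (t : ℝ) (m : Fin n) : ℝ :=
  ∑ j ∈ Finset.univ.erase m, W t m j

theorem aux_ii {n : ℕ} {W : ℝ → Fin n → Fin n → ℝ} (hreg : CRegular n W) (i j : Fin n) (a b : ℝ) :
    IntervalIntegrable (fun t => W t i j) volume a b :=
  (((hreg.2.2 i j).integrableOn_isCompact isCompact_uIcc).mono_set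
    Set.Ioc_subset_Icc_self |> fun h => intervalIntegrable_iff.2 h)

theorem aux_tail {n : ℕ} {W : ℝ → Fin n → Fin n → ℝ} (hreg : CRegular n W)
    (i j : Fin n) (hij : j ≠ i) (hnp : ¬ CPersistent n W j i) (δ : ℝ) (hδ : 0 < δ) :
    ∀ᶠ t in atTop, ∀ u, t ≤ u → ∫ s in t..u, W s i j ≤ δ := by
  unfold CPersistent at hnp
  push Not at hnp
  obtain ⟨s, hs, hT⟩ := hnp hij
  have hmono : Monotone (fun T => ∫ t in s..T, W t i j) := by
    intro a b hab
    have h1 := intervalIntegral.integral_add_adjacent_intervals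
      (aux_ii hreg i j s a) (aux_ii hreg i j a b)
    have h2 : 0 ≤ ∫ t in a..b, W t i j :=
      intervalIntegral.integral_nonneg hab (fun u _ => hreg.1 u i j)
    simp only
    linarith
  rcases tendsto_atTop_of_monotone hmono with h | ⟨l, hl⟩
  · exact absurd h hT
  · have hle : ∀ u, ∫ t in s..u, W t i j ≤ l := fun u => hmono.ge_of_tendsto hl u
    filter_upwards [hl.eventually (lt_mem_nhds (show l - δ < l by linarith))] with t ht u _
    have h1 := intervalIntegral.integral_add_adjacent_intervals
      (aux_ii hreg i j s t) (aux_ii hreg i j t u)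
    have := hle u
    linarith

theorem aux_small {n : ℕ} {W : ℝ → Fin n → Fin n → ℝ} (hreg : CRegular n W)
    (t T δ : ℝ) (hT : 0 ≤ T)
    (hsm : ∀ k m : Fin n, m ≠ k → ∫ s in t..(t + T), W s k m ≤ δ) (hδ : 0 ≤ δ)
    (x : ℝ → Fin n → ℝ) (hx : CSol n W t x) (hx0 : ‖x t‖ ≤ 1) (hη : n * δ ≤ 1 / 16) (k : Fin n) :
    |x (t + T) k - x t k| ≤ 4 * (n * δ) := by
  have hc : ContinuousOn x (Set.Icc t (t + T)) :=
    continuousOn_pi.2 fun i => (hx.1 i).mono Set.Icc_subset_Ici_self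
  obtain ⟨s, hs, hmax⟩ := isCompact_Icc.exists_isMaxOn
    (Set.nonempty_Icc.2 (show t ≤ t + T by linarith)) hc.norm
  have hM : ∀ u ∈ Set.Icc t (t + T), ‖x u‖ ≤ ‖x s‖ := fun u hu => hmax hu
  set M := ‖x s‖ with hMdef
  have hM0 : 0 ≤ M := norm_nonneg _
  have key : ∀ u ∈ Set.Icc t (t + T), ∀ k, |x u k - x t k| ≤ 2 * M * (n * δ) := by
    intro u hu k
    rw [hx.2 k u hu.1, add_sub_cancel_left, ← Real.norm_eq_abs]
    have hint : ∀ m ∈ (Finset.univ : Finset (Fin n)), IntervalIntegrable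
        (fun r => (if m = k then 0 else W r k m) * (2 * M)) volume t u := by
      intro m _
      by_cases h : m = k
      · simp [h]
      · simp only [h, if_false]
        exact (aux_ii hreg k m t u).mul_const _
    have hb : ‖∫ r in t..u, ∑ j, W r k j * (x r j - x r k)‖ ≤
        ∫ r in t..u, ∑ m, (if m = k then 0 else W r k m) * (2 * M) := by
      apply intervalIntegral.norm_integral_le_of_norm_le hu.1
      · refine Eventually.of_forall fun r hr => ?_
        refine (norm_sum_le _ _).trans (Finset.sum_le_sum fun m _ => ?_)
        by_cases h : m = k
        · simp [h]
        · simp only [h, if_false]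
          rw [norm_mul, Real.norm_of_nonneg (hreg.1 r k m)]
          apply mul_le_mul_of_nonneg_left _ (hreg.1 r k m)
          have h0 := hM r ⟨hr.1.le, hr.2.trans hu.2⟩
          have h1 := norm_le_pi_norm (x r) m
          have h2 := norm_le_pi_norm (x r) k
          have h3 := norm_sub_le (x r m) (x r k)
          linarith
      · have hs := IntervalIntegrable.sum
          (f := fun m r => (if m = k then 0 else W r k m) * (2 * M)) _ hint
        have he : (fun r => ∑ m, (if m = k then 0 else W r k m) * (2 * M)) =
            ∑ m, fun r => (if m = k then 0 else W r k m) * (2 * M) := by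
          ext r
          simp only [Finset.sum_apply]
        rw [he]
        exact hs
    refine hb.trans ?_
    rw [intervalIntegral.integral_finsetSum hint]
    have : ∀ m ∈ (Finset.univ : Finset (Fin n)),
        ∫ r in t..u, (if m = k then 0 else W r k m) * (2 * M) ≤ δ * (2 * M) := by
      intro m _
      by_cases h : m = k
      · simp [h]; positivity
      · simp only [h, if_false]
        rw [intervalIntegral.integral_mul_const]
        apply mul_le_mul_of_nonneg_right _ (by positivity)
        refine le_trans ?_ (hsm k m h)
        have h1 := intervalIntegral.integral_add_adjacent_intervals
          (aux_ii hreg k m t u) (aux_ii hreg k m u (t + T))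
        have h2 : 0 ≤ ∫ r in u..(t + T), W r k m :=
          intervalIntegral.integral_nonneg hu.2 (fun r _ => hreg.1 r k m)
        linarith
    refine (Finset.sum_le_sum this).trans ?_
    simp
    linarith
  have hnδ : 0 ≤ n * δ := by positivity
  have hM2 : M ≤ 1 + 2 * M * (n * δ) := by
    rw [hMdef, pi_norm_le_iff_of_nonneg (by positivity)]
    intro k
    have h1 := key s hs k
    have h2 := norm_le_pi_norm (x t) k
    rw [Real.norm_eq_abs] at *
    have h3 := abs_sub_abs_le_abs_sub (x s k) (x t k)
    linarith
  have hM3 : M ≤ 2 := by nlinarith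
  refine (key _ ⟨by linarith, le_refl _⟩ k).trans ?_
  nlinarith

/-- Under A3 and assuming solutions exist, global ε-agreement implies
condition (b). -/
theorem continuous_eps_agreement_implies_arc_condition
    (n : ℕ) (hn : 2 ≤ n) (W : ℝ → Fin n → Fin n → ℝ)
    (hreg : CRegular n W)
    (A : ℝ) (hA : 1 < A) (hA3 : CArcBalance n W A)
    (hex : CSolExists n W)
    (heps : CEpsAgree n W) :
    CArcCond n W := by
  obtain ⟨ε, hε0, hε1, T0, hT0, hag⟩ := heps
  have hn0 : (0 : ℝ) < n := by exact_mod_cast (by omega : 0 < n)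
  obtain ⟨δ, hδdef⟩ : ∃ δ : ℝ, δ = (1 - ε) / (16 * n) := ⟨_, rfl⟩
  have hδ : 0 < δ := by rw [hδdef]; apply div_pos <;> linarith
  have hnδ : n * δ = (1 - ε) / 16 := by rw [hδdef]; field_simp
  have hev : ∀ᶠ t in atTop, ∀ i j : Fin n, j ≠ i → ¬ CPersistent n W j i →
      ∀ u, t ≤ u → ∫ s in t..u, W s i j ≤ δ := by
    rw [eventually_all]; intro i
    rw [eventually_all]; intro j
    by_cases h1 : j ≠ i
    · by_cases h2 : CPersistent n W j i
      · exact Eventually.of_forall fun t _ h => absurd h2 h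
      · filter_upwards [aux_tail hreg i j h1 h2 δ hδ] with t ht _ _
        exact ht
    · exact Eventually.of_forall fun t h => absurd h h1
  obtain ⟨T1, hT1⟩ := eventually_atTop.1 hev
  set Ts := max T1 0 with hTs
  have hTs0 : 0 ≤ Ts := le_max_right _ _
  refine ⟨δ / A, by positivity, Ts + T0, by positivity, ?_⟩
  intro t ht j i hji
  by_contra! hlt
  have ht' : 0 ≤ t + Ts := by linarith
  have hWij : ∫ s in (t + Ts)..(t + Ts + T0), W s i j < δ / A := by
    refine lt_of_le_of_lt ?_ hlt
    have h1 := intervalIntegral.integral_add_adjacent_intervals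
      (aux_ii hreg i j t (t + Ts)) (aux_ii hreg i j (t + Ts) (t + (Ts + T0)))
    have h2 : 0 ≤ ∫ r in t..(t + Ts), W r i j :=
      intervalIntegral.integral_nonneg (by linarith) (fun r _ => hreg.1 r i j)
    rw [add_assoc] at *
    linarith
  have hsm : ∀ k m : Fin n, m ≠ k → ∫ s in (t + Ts)..(t + Ts + T0), W s k m ≤ δ := by
    intro k m hmk
    by_cases hp : CPersistent n W m k
    · have h1 : ∫ s in (t + Ts)..(t + Ts + T0), W s k m ≤
          ∫ s in (t + Ts)..(t + Ts + T0), A * W s i j := by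
        apply intervalIntegral.integral_mono_on (by linarith) (aux_ii hreg k m _ _)
          ((aux_ii hreg i j _ _).const_mul A)
        intro s hs
        exact (hA3 s (ht'.trans hs.1) i j k m hji hp).2
      rw [intervalIntegral.integral_const_mul] at h1
      have h2 : A * (δ / A) = δ := by field_simp
      nlinarith
    · exact hT1 (t + Ts) (by linarith [le_max_left T1 0]) k m hmk hp _ (by linarith)
  obtain ⟨x, hx, hx0⟩ := hex (t + Ts) ht' (fun k => if k = i then 1 else 0)
  have hxn : ‖x (t + Ts)‖ ≤ 1 := by
    rw [pi_norm_le_iff_of_nonneg (by norm_num)]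
    intro k
    rw [hx0]
    split_ifs <;> simp
  have hd := aux_small hreg (t + Ts) T0 δ hT0.le hsm hδ.le x hx hxn (by rw [hnδ]; linarith)
  have hH := hag (t + Ts) ht' x hx (t + Ts) le_rfl
  have hne : Nonempty (Fin n) := ⟨i⟩
  have hH0 : cH n x (t + Ts) ≤ 1 := by
    have h1 : cMax n x (t + Ts) ≤ 1 := ciSup_le fun k => by
      rw [hx0]; split_ifs <;> norm_num
    have h2 : 0 ≤ cMin n x (t + Ts) := le_ciInf fun k => by
      rw [hx0]; split_ifs <;> norm_num
    unfold cH; linarith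
  have hH1 : x (t + Ts + T0) i - x (t + Ts + T0) j ≤ cH n x (t + Ts + T0) := by
    have h1 : x (t + Ts + T0) i ≤ cMax n x (t + Ts + T0) :=
      le_ciSup (Set.finite_range (x (t + Ts + T0))).bddAbove i
    have h2 : cMin n x (t + Ts + T0) ≤ x (t + Ts + T0) j :=
      ciInf_le (Set.finite_range (x (t + Ts + T0))).bddBelow j
    unfold cH; linarith
  have di := abs_le.1 (hd i)
  have dj := abs_le.1 (hd j)
  rw [hx0, hnδ] at di dj
  simp only [if_true, hji.1, if_false] at di dj
  nlinarith [di.1, dj.2]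
end

section
/- Let x be a solution of the continuous-time belief evolution and suppose that for some node m, some time s ≥ t0, and some constant μ ∈ [0,1], x_m(s) ≤ μ ψ(s) + (1−μ) Ψ(s). Then for all t ≥ s, x_m(t) ≤ μ exp(−∫_s^t ξ⁺(τ;m) dτ) · ψ(s) + (1 − μ exp(−∫_s^t ξ⁺(τ;m) dτ)) · Ψ(s). -/
open Filter Finset MeasureTheory

theorem ac_exp {f : ℝ → ℝ} {a b : ℝ} (hf : AbsolutelyContinuousOnInterval f a b) :
    AbsolutelyContinuousOnInterval (fun r => Real.exp (f r)) a b := by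
  obtain ⟨C, hC⟩ := hf.exists_bound
  obtain ⟨L, hL⟩ := (Real.contDiff_exp (n := 1)).contDiffOn.exists_lipschitzOnWith
    (s := Set.Icc (-C) C) (by decide) (convex_Icc _ _) isCompact_Icc
  rw [absolutelyContinuousOnInterval_iff] at hf ⊢
  intro ε hε
  obtain ⟨δ, hδ, h⟩ := hf (ε / (L + 1)) (by positivity)
  refine ⟨δ, hδ, fun E hE hlt => ?_⟩
  have h1 := h E hE hlt
  have hmem : ∀ r ∈ Set.uIcc a b, f r ∈ Set.Icc (-C) C := fun r hr => by
    have := hC r hr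
    rw [Real.norm_eq_abs, abs_le] at this
    exact this
  calc ∑ i ∈ Finset.range E.1, dist (Real.exp (f (E.2 i).1)) (Real.exp (f (E.2 i).2))
      ≤ ∑ i ∈ Finset.range E.1, (L : ℝ) * dist (f (E.2 i).1) (f (E.2 i).2) := by
        apply Finset.sum_le_sum
        intro i hi
        exact hL.dist_le_mul _ (hmem _ (hE.1 i hi).1) _ (hmem _ (hE.1 i hi).2)
    _ = L * ∑ i ∈ Finset.range E.1, dist (f (E.2 i).1) (f (E.2 i).2) :=
        (Finset.mul_sum _ _ _).symm
    _ ≤ L * (ε / (L + 1)) := by gcongr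
    _ < (L + 1) * (ε / (L + 1)) := by gcongr; linarith
    _ = ε := by field

theorem int_factor {s t : ℝ} (hst : s ≤ t) {k f y : ℝ → ℝ}
    (hk : IntervalIntegrable k volume s t) (hf : IntervalIntegrable f volume s t)
    (hy : ∀ r ∈ Set.Icc s t, y r = y s + ∫ u in s..r, f u)
    (hle : ∀ r ∈ Set.Icc s t, f r + k r * y r ≤ 0) :
    y t * Real.exp (∫ u in s..t, k u) ≤ y s := by
  have hs : s ∈ Set.uIcc s t := Set.left_mem_uIcc
  have hc : AbsolutelyContinuousOnInterval (fun _ : ℝ => y s) s t :=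
    (contDiff_const (n := 1)).contDiffOn.absolutelyContinuousOnInterval
  have hP := (hc.fun_add (hf.absolutelyContinuousOnInterval_intervalIntegral hs)).fun_mul
    (ac_exp (hk.absolutelyContinuousOnInterval_intervalIntegral hs))
  have hi := hP.integral_deriv_eq_sub
  have hnn : 0 ≤ ∫ r in s..t, -deriv (fun x => (y s + ∫ v in s..x, f v) *
      Real.exp (∫ v in s..x, k v)) r := by
    apply intervalIntegral.integral_nonneg_of_ae_restrict hst
    rw [Filter.EventuallyLE, MeasureTheory.ae_restrict_iff' measurableSet_Icc]
    filter_upwards [hk.ae_hasDerivAt_integral, hf.ae_hasDerivAt_integral] with r h1 h2 hr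
    have hr' : r ∈ Set.uIcc s t := by rwa [Set.uIcc_of_le hst]
    have hd := ((h2 hr' s hs).const_add (y s)).mul (h1 hr' s hs).exp
    have hd' := hd.deriv
    have := hle r hr
    rw [hy r hr] at this
    have he := Real.exp_pos (∫ v in s..r, k v)
    have h3 : deriv (fun x => (y s + ∫ v in s..x, f v) *
      Real.exp (∫ v in s..x, k v)) r = (f r + k r * (y s + ∫ v in s..r, f v)) *
        Real.exp (∫ v in s..r, k v) := by
      refine Eq.trans hd' ?_
      ring
    rw [h3]
    simp only [Pi.zero_apply]
    nlinarith
  rw [intervalIntegral.integral_neg, hi] at hnn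
  rw [hy t ⟨hst, le_rfl⟩]
  simpa using hnn

theorem upper_step {n : ℕ} {W : ℝ → Fin n → Fin n → ℝ} (hreg : CRegular n W)
    {t0 : ℝ} {x : ℝ → Fin n → ℝ} (hx : CSol n W t0 x) (i : Fin n) {s t C : ℝ}
    (hs : t0 ≤ s) (hst : s ≤ t) (hC : ∀ r ∈ Set.Icc s t, ∀ j, x r j ≤ C) :
    (x t i - C) * Real.exp (∫ u in s..t, cXi n W u i) ≤ x s i - C := by
  obtain ⟨hW0, -, hWl⟩ := hreg
  obtain ⟨hcont, hsol⟩ := hx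
  have hWi : ∀ j (a b : ℝ), IntervalIntegrable (fun u => W u i j) volume a b := fun j a b =>
    intervalIntegrable_iff.mpr <|
      ((hWl i j).integrableOn_isCompact isCompact_uIcc).mono_set Set.uIoc_subset_uIcc
  have hfi : ∀ a b, t0 ≤ a → t0 ≤ b →
      IntervalIntegrable (fun u => ∑ j, W u i j * (x u j - x u i)) volume a b := by
    intro a b ha hb
    have : (fun u => ∑ j, W u i j * (x u j - x u i)) =
        ∑ j, (fun u => W u i j * (x u j - x u i)) := by ext u; simp
    rw [this]
    apply IntervalIntegrable.sum
    intro j _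
    apply (hWi j a b).mul_continuousOn
    apply ((hcont j).sub (hcont i)).mono
    intro r hr
    exact (le_min ha hb).trans hr.1
  have hki : IntervalIntegrable (fun u => cXi n W u i) volume s t := by
    have : (fun u => cXi n W u i) = ∑ j ∈ Finset.univ.erase i, (fun u => W u i j) := by
      ext u; simp [cXi]
    rw [this]
    exact IntervalIntegrable.sum _ fun j _ => hWi j s t
  refine int_factor (y := fun r => x r i - C) hst hki (hfi s t hs (hs.trans hst)) ?_ ?_
  · intro r hr
    have h1 := hsol i s hs
    have h2 := hsol i r (hs.trans hr.1)
    have h3 := intervalIntegral.integral_add_adjacent_intervals (hfi t0 s le_rfl hs)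
      (hfi s r hs (hs.trans hr.1))
    linarith
  · intro r hr
    simp only [cXi]
    rw [← Finset.sum_erase (a := i) Finset.univ (by simp), Finset.sum_mul,
      ← Finset.sum_add_distrib]
    apply Finset.sum_nonpos
    intro j _
    nlinarith [mul_nonneg (hW0 r i j) (sub_nonneg.2 (hC r hr j))]

theorem max_principle {n : ℕ} {W : ℝ → Fin n → Fin n → ℝ} (hreg : CRegular n W)
    {t0 : ℝ} {x : ℝ → Fin n → ℝ} (hx : CSol n W t0 x) {s t : ℝ}
    (hs : t0 ≤ s) (hst : s ≤ t) (j : Fin n) : x t j ≤ cMax n x s := by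
  have hb : ∀ r, BddAbove (Set.range fun i => x r i) := fun r => (Set.finite_range _).bddAbove
  have hmax : ∀ i : Fin n, ∃ r ∈ Set.Icc s t, ∀ q ∈ Set.Icc s t, x q i ≤ x r i := fun i => by
    obtain ⟨r, hr, h⟩ := isCompact_Icc.exists_isMaxOn (Set.nonempty_Icc.2 hst)
      ((hx.1 i).mono (fun r (hr : r ∈ Set.Icc s t) => hs.trans hr.1))
    exact ⟨r, hr, fun q hq => h hq⟩
  choose r hr hrm using hmax
  have : Nonempty (Fin n) := ⟨j⟩
  obtain ⟨i, hi⟩ := Finite.exists_max fun i => x (r i) i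
  have h1 := upper_step hreg hx i hs (hr i).1 (C := x (r i) i) fun q hq l =>
    (hrm l q ⟨hq.1, hq.2.trans (hr i).2⟩).trans (hi l)
  have h2 : x s i ≤ cMax n x s := le_ciSup (hb s) i
  have h3 := hrm j t ⟨hst, le_rfl⟩
  have h4 := hi j
  rw [sub_self, zero_mul] at h1
  linarith

/-- If x_m(s) ≤ μψ(s) + (1−μ)Ψ(s), then for all t ≥ s,
x_m(t) ≤ μ·exp(−∫_s^t ξ⁺(τ;m)dτ)·ψ(s) + (1 − μ·exp(−∫_s^t ξ⁺(τ;m)dτ))·Ψ(s). -/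
theorem continuous_upper_bound_lemma
    (n : ℕ) (hn : 2 ≤ n) (W : ℝ → Fin n → Fin n → ℝ)
    (hreg : CRegular n W)
    (t0 : ℝ) (x : ℝ → Fin n → ℝ) (hx : CSol n W t0 x)
    (m : Fin n) (s : ℝ) (hs : t0 ≤ s)
    (μ : ℝ) (hμ0 : 0 ≤ μ) (hμ1 : μ ≤ 1)
    (hxm : x s m ≤ μ * cMin n x s + (1 - μ) * cMax n x s) :
    ∀ t : ℝ, s ≤ t →
      x t m ≤ μ * Real.exp (-(∫ τ in s..t, cXi n W τ m)) * cMin n x s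
        + (1 - μ * Real.exp (-(∫ τ in s..t, cXi n W τ m))) * cMax n x s := by
  intro t hst
  have h1 := upper_step hreg hx m hs hst (C := cMax n x s)
    fun r hr j => max_principle hreg hx hs hr.1 j
  rw [Real.exp_neg]
  have he := Real.exp_pos (∫ u in s..t, cXi n W u m)
  set e := Real.exp (∫ u in s..t, cXi n W u m)
  have h2 : (x t m - cMax n x s) * e ≤ μ * (cMin n x s - cMax n x s) := by linarith
  rw [← le_div_iff₀ he, div_eq_mul_inv] at h2
  linarith
end

section
/- Every solution of the continuous-time belief evolution satisfies, for all t ≥ t0, H(t) ≥ exp(−2 ∑_{(j,i): j≠i} ∫_{t0}^t W_ij(τ) dτ) · H(t0), where the sum is over all ordered pairs of distinct nodes. -/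
open Filter Finset MeasureTheory

lemma aux_gron (H S : ℝ → ℝ) (a₀ b₀ : ℝ) (hS : LocallyIntegrable S) (hS0 : ∀ t, 0 ≤ S t)
    (hH0 : ∀ t, 0 ≤ H t) (hc : ContinuousOn H (Set.Icc a₀ b₀))
    (hM : ∀ a b M, a₀ ≤ a → a ≤ b → b ≤ b₀ → (∀ r ∈ Set.Icc a b, H r ≤ M) →
      H a ≤ H b + M * ∫ r in a..b, S r) (h : a₀ ≤ b₀) :
    H a₀ ≤ Real.exp (2 * ∫ r in a₀..b₀, S r) * H b₀ := by
  have hI : ∀ a b, IntervalIntegrable S volume a b := fun a b => (hS.integrableOn_isCompact isCompact_uIcc).intervalIntegrable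
  -- local step
  have step : ∀ a b, a₀ ≤ a → a ≤ b → b ≤ b₀ → (∫ r in a..b, S r) ≤ 1 / 2 →
      H a ≤ Real.exp (2 * ∫ r in a..b, S r) * H b := by
    intro a b h1 h2 h3 h4
    obtain ⟨m, hm, hmax⟩ := isCompact_Icc.exists_isMaxOn (Set.nonempty_Icc.2 h2)
      (hc.mono (Set.Icc_subset_Icc h1 h3))
    have hmax' : ∀ r ∈ Set.Icc a b, H r ≤ H m := fun r hr => hmax hr
    have k1 := hM m b (H m) (h1.trans hm.1) hm.2 h3
      (fun r hr => hmax' r ⟨hm.1.trans hr.1, hr.2⟩)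
    have k2 : (∫ r in m..b, S r) ≤ ∫ r in a..b, S r := by
      rw [← intervalIntegral.integral_add_adjacent_intervals (hI a m) (hI m b)]
      linarith [intervalIntegral.integral_nonneg (μ := volume) hm.1 (fun r _ => hS0 r)]
    have k3 : 0 ≤ ∫ r in a..b, S r := intervalIntegral.integral_nonneg h2 (fun r _ => hS0 r)
    set c := ∫ r in a..b, S r
    have k4 : H m * (1 - c) ≤ H b := by
      have := mul_le_mul_of_nonneg_left k2 (hH0 m)
      linarith
    have k5 : 1 ≤ Real.exp (2 * c) * (1 - c) := by
      have := Real.add_one_le_exp (2 * c)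
      nlinarith
    calc H a ≤ H m := hmax' a ⟨le_rfl, h2⟩
      _ ≤ (Real.exp (2 * c) * (1 - c)) * H m := le_mul_of_one_le_left (hH0 m) k5
      _ = Real.exp (2 * c) * (H m * (1 - c)) := by ring
      _ ≤ _ := by gcongr
  have huc : UniformContinuousOn (fun t => ∫ r in a₀..t, S r) (Set.Icc a₀ b₀) :=
    isCompact_Icc.uniformContinuousOn_of_continuous
      (intervalIntegral.continuous_primitive hI a₀).continuousOn
  obtain ⟨δ, hδ, hd⟩ := Metric.uniformContinuousOn_iff.1 huc (1 / 2) (by norm_num)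
  have step' : ∀ a b, a₀ ≤ a → a ≤ b → b ≤ b₀ → b - a < δ →
      H a ≤ Real.exp (2 * ∫ r in a..b, S r) * H b := by
    intro a b h1 h2 h3 h4
    refine step a b h1 h2 h3 ?_
    have := hd b ⟨h1.trans h2, h3⟩ a ⟨h1, h2.trans h3⟩
      (by rw [Real.dist_eq, abs_of_nonneg (by linarith)]; exact h4)
    rw [Real.dist_eq, intervalIntegral.integral_interval_sub_left (hI _ _) (hI _ _)] at this
    exact (le_abs_self _).trans this.le
  have main : ∀ k : ℕ, ∀ b, a₀ ≤ b → b ≤ b₀ → b - a₀ ≤ k * (δ / 2) →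
      H a₀ ≤ Real.exp (2 * ∫ r in a₀..b, S r) * H b := by
    intro k
    induction k with
    | zero =>
      intro b h1 h2 h3
      have : b = a₀ := by
        simp at h3
        linarith
      subst this
      simp
    | succ k ih =>
      intro b h1 h2 h3
      push_cast at h3
      have hle : max a₀ (b - δ / 2) ≤ b := max_le h1 (by linarith)
      have e1 := ih (max a₀ (b - δ / 2)) (le_max_left _ _) (hle.trans h2) (by
        have : max a₀ (b - δ / 2) ≤ a₀ + k * (δ / 2) := max_le (by
          have : (0:ℝ) ≤ k * (δ / 2) := by positivity
          linarith) (by linarith)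
        linarith)
      have e2 := step' (max a₀ (b - δ / 2)) b (le_max_left _ _) hle h2 (by
        linarith [le_max_right a₀ (b - δ / 2)])
      rw [← intervalIntegral.integral_add_adjacent_intervals (hI a₀ (max a₀ (b - δ / 2)))
        (hI (max a₀ (b - δ / 2)) b), mul_add, Real.exp_add, mul_assoc]
      exact e1.trans (mul_le_mul_of_nonneg_left e2 (Real.exp_pos _).le)
  obtain ⟨k, hk⟩ := exists_nat_ge ((b₀ - a₀) / (δ / 2))
  exact main k b₀ h le_rfl (by rwa [div_le_iff₀ (by positivity)] at hk)

/-- Every solution satisfies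
H(t) ≥ exp(−2·∑_{(j,i): j≠i} ∫_{t0}^t W_ij(τ)dτ)·H(t0) for all t ≥ t0. -/
theorem continuous_lower_bound_on_H
    (n : ℕ) (hn : 2 ≤ n) (W : ℝ → Fin n → Fin n → ℝ)
    (hreg : CRegular n W)
    (t0 : ℝ) (x : ℝ → Fin n → ℝ) (hx : CSol n W t0 x) :
    ∀ t : ℝ, t0 ≤ t →
      cH n x t ≥
        Real.exp (-2 * ∑ i : Fin n, ∑ j ∈ Finset.univ.erase i, ∫ τ in t0..t, W τ i j)
          * cH n x t0 := by
  intro t ht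
  obtain ⟨hW0, -, hWI⟩ := hreg
  obtain ⟨hxc, hxe⟩ := hx
  have hne : Nonempty (Fin n) := ⟨⟨0, by omega⟩⟩
  have hup : ∀ s i, x s i ≤ cMax n x s := fun s i =>
    le_ciSup (f := fun i => x s i) (Set.finite_range _).bddAbove i
  have hlo : ∀ s i, cMin n x s ≤ x s i := fun s i =>
    ciInf_le (f := fun i => x s i) (Set.finite_range _).bddBelow i
  have hdiff : ∀ s i j, x s i - x s j ≤ cH n x s := fun s i j => by
    unfold cH
    linarith [hup s i, hlo s j]
  have hH0 : ∀ s, 0 ≤ cH n x s := fun s => by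
    simpa using hdiff s hne.some hne.some
  have hatt : ∀ s, ∃ i j, cH n x s = x s i - x s j := fun s => by
    obtain ⟨i, hi⟩ := exists_eq_ciSup_of_finite (f := fun i => x s i)
    obtain ⟨j, hj⟩ := exists_eq_ciInf_of_finite (f := fun i => x s i)
    exact ⟨i, j, by unfold cH cMax cMin; rw [← hi, ← hj]⟩
  have hcont : ContinuousOn (cH n x) (Set.Icc t0 t) := by
    have h1 : ContinuousOn (cMax n x) (Set.Icc t0 t) := by
      have : cMax n x = fun s => Finset.univ.sup' Finset.univ_nonempty (fun i => x s i) := by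
        ext s
        rw [Finset.sup'_univ_eq_ciSup]; rfl
      rw [this]
      exact ContinuousOn.finset_sup'_apply _ fun i _ => (hxc i).mono Set.Icc_subset_Ici_self
    have h2 : ContinuousOn (cMin n x) (Set.Icc t0 t) := by
      have : cMin n x = fun s => Finset.univ.inf' Finset.univ_nonempty (fun i => x s i) := by
        ext s
        rw [Finset.inf'_univ_eq_ciInf]; rfl
      rw [this]
      exact ContinuousOn.finset_inf'_apply _ fun i _ => (hxc i).mono Set.Icc_subset_Ici_self
    exact h1.sub h2
  have hWii : ∀ i j a b, IntervalIntegrable (fun s => W s i j) volume a b :=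
    fun i j a b => ((hWI i j).integrableOn_isCompact isCompact_uIcc).intervalIntegrable
  have hxi0 : ∀ s i, 0 ≤ cXi n W s i := fun s i => Finset.sum_nonneg fun j _ => hW0 s i j
  have hxiI : ∀ i a b, IntervalIntegrable (fun s => cXi n W s i) volume a b := fun i a b => by
    unfold cXi
    exact ((locallyIntegrable_finsetSum _ fun j _ => hWI i j).integrableOn_isCompact isCompact_uIcc).intervalIntegrable
  have hxiL : ∀ i, LocallyIntegrable (fun s => cXi n W s i) := fun i => by
    unfold cXi
    exact locallyIntegrable_finsetSum _ fun j _ => hWI i j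
  have hSL : LocallyIntegrable (fun s => ∑ i, cXi n W s i) :=
    locallyIntegrable_finsetSum _ fun i _ => hxiL i
  have hfI : ∀ i a b, t0 ≤ a → a ≤ b → IntervalIntegrable
      (fun s => ∑ j, W s i j * (x s j - x s i)) volume a b := fun i a b ha hab => by
    have hsub : Set.uIcc a b ⊆ Set.Ici t0 := by
      rw [Set.uIcc_of_le hab]
      exact fun y hy => ha.trans hy.1
    have := IntervalIntegrable.sum (μ := volume) (a := a) (b := b) Finset.univ
      (f := fun j s => W s i j * (x s j - x s i)) (fun j _ =>
        (hWii i j a b).mul_continuousOn (((hxc j).sub (hxc i)).mono hsub))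
    refine this.congr (fun s _ => ?_)
    simp
  have hbd : ∀ i a b M, t0 ≤ a → a ≤ b → (∀ r ∈ Set.Icc a b, cH n x r ≤ M) →
      |x b i - x a i| ≤ M * ∫ s in a..b, cXi n W s i := by
    intro i a b M ha hab hM
    have e : x b i - x a i = ∫ s in a..b, ∑ j, W s i j * (x s j - x s i) := by
      rw [hxe i b (ha.trans hab), hxe i a ha,
        ← intervalIntegral.integral_add_adjacent_intervals (hfI i t0 a le_rfl ha)
          (hfI i a b ha hab)]
      ring
    rw [e, ← intervalIntegral.integral_const_mul, ← Real.norm_eq_abs]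
    refine intervalIntegral.norm_integral_le_of_norm_le hab ?_ ((hxiI i a b).const_mul M)
    refine Filter.Eventually.of_forall fun s hs => ?_
    rw [← Finset.sum_erase (a := i) _ (by simp)]
    unfold cXi
    rw [Finset.mul_sum]
    refine (norm_sum_le _ _).trans (Finset.sum_le_sum fun j _ => ?_)
    rw [Real.norm_eq_abs, abs_mul, abs_of_nonneg (hW0 s i j), mul_comm]
    refine mul_le_mul_of_nonneg_right ?_ (hW0 s i j)
    have := hM s ⟨hs.1.le, hs.2⟩
    exact abs_le.2 ⟨by linarith [hdiff s i j], by linarith [hdiff s j i]⟩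
  have key := aux_gron (cH n x) (fun s => ∑ i, cXi n W s i) t0 t hSL
    (fun s => Finset.sum_nonneg fun i _ => hxi0 s i) hH0 hcont (by
      intro a b M ha hab hb hM
      have hM0 : 0 ≤ M := (hH0 a).trans (hM a ⟨le_rfl, hab⟩)
      rw [intervalIntegral.integral_finsetSum fun i _ => hxiI i a b]
      have hnn : ∀ i, 0 ≤ ∫ s in a..b, cXi n W s i := fun i =>
        intervalIntegral.integral_nonneg hab fun s _ => hxi0 s i
      obtain ⟨i, k, hik⟩ := hatt a
      rw [hik]
      by_cases hne : i = k
      · subst hne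
        have := Finset.sum_nonneg fun i (_ : i ∈ Finset.univ) => hnn i
        have := hH0 b
        rw [sub_self]
        positivity
      · have h1 := abs_le.1 (hbd i a b M ha hab hM)
        have h2 := abs_le.1 (hbd k a b M ha hab hM)
        have h3 := Finset.sum_le_univ_sum_of_nonneg (s := {i, k}) hnn
        rw [Finset.sum_pair hne] at h3
        have h4 := mul_le_mul_of_nonneg_left h3 hM0
        linarith [hdiff b i k, h1.1, h2.2]) ht
  have hE : ∫ r in t0..t, ∑ i, cXi n W r i
      = ∑ i : Fin n, ∑ j ∈ Finset.univ.erase i, ∫ τ in t0..t, W τ i j := by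
    rw [intervalIntegral.integral_finsetSum fun i _ => hxiI i t0 t]
    refine Finset.sum_congr rfl fun i _ => ?_
    unfold cXi
    rw [intervalIntegral.integral_finsetSum fun j _ => hWii i j t0 t]
  rw [← hE, ge_iff_le, neg_mul, Real.exp_neg, inv_mul_le_iff₀ (Real.exp_pos _)]
  exact key
end

section
/- Let V_1, …, V_n : ℝ → ℝ be continuously differentiable functions and define V(t) = max_{i=1,…,n} V_i(t). For each t let I(t) = { i : V_i(t) = V(t) } be the set of indices where the maximum is attained. Then the upper Dini derivative of V at t satisfies D⁺V(t) = max_{i ∈ I(t)} V_i'(t), where D⁺V(t) = limsup_{s → 0⁺} (V(t+s) − V(t))/s. -/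
open Filter

/-- The upper Dini derivative of `h` at `t`: limsup_{s→0⁺} (h(t+s) − h(t))/s. -/
noncomputable def upperDini (h : ℝ → ℝ) (t : ℝ) : ℝ :=
  Filter.limsup (fun s => (h (t + s) - h t) / s) (nhdsWithin 0 (Set.Ioi (0 : ℝ)))

/-- For C¹ functions V_1, …, V_n and V(t) = max_i V_i(t), the upper Dini
derivative of V at t equals the maximum of V_i'(t) over the indices attaining the maximum. -/
theorem dini_derivative_of_max
    (n : ℕ) (hn : 1 ≤ n) (V : Fin n → ℝ → ℝ)
    (hV : ∀ i, ContDiff ℝ 1 (V i)) (t : ℝ) :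
    upperDini (fun τ => ⨆ i, V i τ) t =
      ⨆ i : {i : Fin n // V i t = ⨆ j, V j t}, deriv (V (i : Fin n)) t := by
  haveI : Nonempty (Fin n) := ⟨⟨0, hn⟩⟩
  have hbdd : ∀ τ, BddAbove (Set.range fun i => V i τ) := fun τ => (Set.finite_range _).bddAbove
  obtain ⟨k, hk⟩ := exists_eq_ciSup_of_finite (f := fun i => V i t)
  haveI : Nonempty {i : Fin n // V i t = ⨆ j, V j t} := ⟨⟨k, hk⟩⟩
  have hquot : ∀ i, Tendsto (fun s => (V i (t + s) - V i t) / s)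
      (nhdsWithin 0 (Set.Ioi (0 : ℝ))) (nhds (deriv (V i) t)) := by
    intro i
    have h := ((hV i).differentiable (by norm_num) t).hasDerivAt.tendsto_slope_zero_right
    refine h.congr fun s => ?_
    simp only [smul_eq_mul]
    ring
  have hcont : ∀ i, Tendsto (fun s => V i (t + s))
      (nhdsWithin 0 (Set.Ioi (0 : ℝ))) (nhds (V i t)) := by
    intro i
    have h : Continuous fun s => V i (t + s) := (hV i).continuous.comp (by fun_prop)
    have h2 := h.tendsto 0
    simp only [add_zero] at h2
    exact h2.mono_left nhdsWithin_le_nhds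
  have hpos : ∀ᶠ s in nhdsWithin 0 (Set.Ioi (0 : ℝ)), 0 < s := self_mem_nhdsWithin
  unfold upperDini
  apply Tendsto.limsup_eq
  rw [tendsto_order]
  constructor
  · intro a ha
    obtain ⟨⟨i, hi⟩, hi2⟩ := exists_eq_ciSup_of_finite
      (f := fun i : {i : Fin n // V i t = ⨆ j, V j t} => deriv (V (i : Fin n)) t)
    rw [← hi2] at ha
    filter_upwards [hpos, (hquot i).eventually (lt_mem_nhds ha)] with s hs h
    refine h.trans_le ?_
    have := le_ciSup (hbdd (t + s)) i
    simp only [← hi]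
    gcongr
  · intro b hb
    have key : ∀ i, ∀ᶠ s in nhdsWithin 0 (Set.Ioi (0 : ℝ)),
        V i (t + s) < (⨆ j, V j t) + b * s := by
      intro i
      by_cases hi : V i t = ⨆ j, V j t
      · have h1 : deriv (V i) t < b := lt_of_le_of_lt
          (le_ciSup (f := fun i : {i : Fin n // V i t = ⨆ j, V j t} => deriv (V (i : Fin n)) t)
            (Set.finite_range _).bddAbove ⟨i, hi⟩) hb
        filter_upwards [hpos, (hquot i).eventually (gt_mem_nhds h1)] with s hs h
        rw [div_lt_iff₀ hs] at h
        linarith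
      · have h1 : V i t < ⨆ j, V j t := lt_of_le_of_ne (le_ciSup (hbdd t) i) hi
        have h2 : Tendsto (fun s : ℝ => (⨆ j, V j t) + b * s)
            (nhdsWithin 0 (Set.Ioi (0 : ℝ))) (nhds (⨆ j, V j t)) := by
          have h : Continuous fun s : ℝ => (⨆ j, V j t) + b * s := by fun_prop
          have h2 := h.tendsto 0
          simp only [mul_zero, add_zero] at h2
          exact h2.mono_left nhdsWithin_le_nhds
        exact (hcont i).eventually_lt h2 h1
    filter_upwards [hpos, eventually_all.2 key] with s hs h
    obtain ⟨i, hi⟩ := exists_eq_ciSup_of_finite (f := fun i => V i (t + s))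
    rw [div_lt_iff₀ hs, ← hi]
    have := h i
    linarith
end
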